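/- There exists an absolute constant K < ∞ with the following property. Let A ⊆ ℝ be a Lebesgue measurable set of positive, finite measure, let ε > 0, and let 0 < λ < 1. Suppose that for every pair ρ, ρ′ ≥ 0 with ρ + ρ′ = (1−λ)|A| there exists a bounded interval I ⊆ ℝ such that |A_{ρ,ρ′} △ I| ≤ ε|A|. Then there exists a bounded interval 𝓘 ⊆ ℝ such that |A △ 𝓘| ≤ K λ⁻¹ ε |A|. -/

import Mathlib

open MeasureTheory Set Pointwise

/-- Lebesgue measure of a set of reals, as a real number. -/
noncomputable def lm (S : Set ℝ) : ℝ := (MeasureTheory.volume S).toReal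

/-- Convolution of indicator functions: `(1_A ∗ 1_B)(x) = ∫ 1_A(y) 1_B(x−y) dy`. -/
noncomputable def cv (A B : Set ℝ) (x : ℝ) : ℝ :=
  ∫ y, A.indicator (1 : ℝ → ℝ) y * B.indicator (1 : ℝ → ℝ) (x - y)

/-- The pairing `⟨1_A ∗ 1_B, 1_C⟩ = ∫ (1_A ∗ 1_B) · 1_C`. -/
noncomputable def pr (A B C : Set ℝ) : ℝ := ∫ x, cv A B x * C.indicator (1 : ℝ → ℝ) x

/-- The symmetric rearrangement `S⋆`: the open interval centered at 0 with `|S⋆| = |S|`. -/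
noncomputable def sstar (S : Set ℝ) : Set ℝ := Set.Ioo (-(lm S / 2)) (lm S / 2)

/-- The Riesz–Sobolev deficit `D(A,B,C) = ⟨1_{A⋆}∗1_{B⋆},1_{C⋆}⟩ − ⟨1_A∗1_B,1_C⟩`. -/
noncomputable def rsD (A B C : Set ℝ) : ℝ := pr (sstar A) (sstar B) (sstar C) - pr A B C

/-- The superlevel set `S_{A,B}(t) = {x : (1_A ∗ 1_B)(x) > t}`. -/
def slev (A B : Set ℝ) (t : ℝ) : Set ℝ := {x | cv A B x > t}

/-- The KPRGT deficit `D′(A,B,τ) = (|A|−τ)(|B|−τ) − ∫_τ^∞ |S_{A,B}(t)| dt`. -/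
noncomputable def kD (A B : Set ℝ) (τ : ℝ) : ℝ :=
  (lm A - τ) * (lm B - τ) - ∫ t in Set.Ioi τ, lm (slev A B t)

/-- `η`-strict admissibility of the ordered triple `(A,B,C)`:
`|X| + |Y| ≥ |Z| + η·max(|A|,|B|,|C|)` for every permutation `(X,Y,Z)` of `(A,B,C)`. -/
def adm (η : ℝ) (A B C : Set ℝ) : Prop :=
  lm A + lm B ≥ lm C + η * max (lm A) (max (lm B) (lm C)) ∧
  lm A + lm C ≥ lm B + η * max (lm A) (max (lm B) (lm C)) ∧
  lm B + lm C ≥ lm A + η * max (lm A) (max (lm B) (lm C))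

/-- The truncation `S_{η,η′} = S ∩ [a,b]`, where `a` is the smallest real with
`|S ∩ (−∞,a)| = η` (no lower truncation when `η = 0`) and `b` is the largest real
with `|S ∩ (b,∞)| = η′` (no upper truncation when `η′ = 0`). -/
noncomputable def trunc (S : Set ℝ) (η ηp : ℝ) : Set ℝ :=
  S ∩ (if η = 0 then Set.univ
        else Set.Ici (sInf {a : ℝ | lm (S ∩ Set.Iio a) = η}))
    ∩ (if ηp = 0 then Set.univ
        else Set.Iic (sSup {b : ℝ | lm (S ∩ Set.Ioi b) = ηp}))


section Distribution

open Filter Topology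

variable {A : Set ℝ}

lemma lm_nonneg (S : Set ℝ) : 0 ≤ lm S := ENNReal.toReal_nonneg

lemma lm_mono {S T : Set ℝ} (h : S ⊆ T) (hT : volume T ≠ ⊤) : lm S ≤ lm T :=
  measureReal_mono h hT

lemma lm_union_le (S T : Set ℝ) : lm (S ∪ T) ≤ lm S + lm T := measureReal_union_le S T

lemma lm_le_add {S T U : Set ℝ} (h : S ⊆ T ∪ U) (hT : volume T ≠ ⊤) (hU : volume U ≠ ⊤) :
    lm S ≤ lm T + lm U :=
  (lm_mono h (measure_union_ne_top hT hU)).trans (lm_union_le T U)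

lemma volume_inter_ne_top (hfin : volume A ≠ ⊤) (S : Set ℝ) : volume (A ∩ S) ≠ ⊤ :=
  measure_ne_top_of_subset inter_subset_left hfin

lemma lm_inter_Iio_add_lm_inter_Ici (hfin : volume A ≠ ⊤) (x : ℝ) :
    lm (A ∩ Iio x) + lm (A ∩ Ici x) = lm A := by
  have h := measureReal_inter_add_sdiff (μ := volume) (s := A) (t := Iio x) measurableSet_Iio hfin
  rwa [sdiff_eq, compl_Iio] at h

lemma lm_inter_Ioi (hfin : volume A ≠ ⊤) (x : ℝ) :
    lm (A ∩ Ioi x) = lm A - lm (A ∩ Iio x) := by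
  have h : lm (A ∩ Ioi x) = lm (A ∩ Ici x) :=
    measureReal_congr (ae_eq_set_inter (ae_eq_refl A) Ioi_ae_eq_Ici)
  linarith [lm_inter_Iio_add_lm_inter_Ici hfin x]

lemma lm_inter_Iio_mono (hfin : volume A ≠ ⊤) : Monotone fun x ↦ lm (A ∩ Iio x) :=
  fun _ _ h ↦ lm_mono (inter_subset_inter_right A (Iio_subset_Iio h)) (volume_inter_ne_top hfin _)

lemma lm_Ico_diff (hA : MeasurableSet A) (hfin : volume A ≠ ⊤) {x y : ℝ} (h : x ≤ y) :
    lm (Ico x y \ A) = (y - x) - (lm (A ∩ Iio y) - lm (A ∩ Iio x)) := by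
  have h1 : lm (Ico x y ∩ A) + lm (Ico x y \ A) = lm (Ico x y) :=
    measureReal_inter_add_sdiff hA (by simp)
  have h2 : lm ((A ∩ Iio y) ∩ Iio x) + lm ((A ∩ Iio y) \ Iio x) = lm (A ∩ Iio y) :=
    measureReal_inter_add_sdiff measurableSet_Iio (volume_inter_ne_top hfin _)
  have h3 : (A ∩ Iio y) ∩ Iio x = A ∩ Iio x := by
    ext z; simp only [mem_inter_iff, mem_Iio]
    exact ⟨fun hz ↦ ⟨hz.1.1, hz.2⟩, fun hz ↦ ⟨⟨hz.1, hz.2.trans_le h⟩, hz.2⟩⟩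
  have h4 : (A ∩ Iio y) \ Iio x = Ico x y ∩ A := by
    ext z; simp only [mem_inter_iff, mem_Iio, Set.mem_sdiff, mem_Ico, not_lt]; tauto
  have h5 : lm (Ico x y) = y - x := by
    simp [lm, h]
  rw [h3, h4] at h2
  linarith

lemma continuous_lm_inter_Iio (hA : MeasurableSet A) (hfin : volume A ≠ ⊤) :
    Continuous fun x ↦ lm (A ∩ Iio x) := by
  have h : LipschitzWith 1 fun x ↦ lm (A ∩ Iio x) := by
    refine LipschitzWith.of_le_add fun x y ↦ ?_
    rcases le_total x y with hxy | hxy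
    · linarith [lm_inter_Iio_mono hfin hxy, dist_nonneg (x := x) (y := y)]
    · rw [Real.dist_eq, abs_of_nonneg (sub_nonneg.2 hxy)]
      linarith [lm_Ico_diff hA hfin hxy, lm_nonneg (Ico y x \ A)]
  exact h.continuous

lemma exists_lt_lm_inter_Iio (hfin : volume A ≠ ⊤) {r : ℝ} (hr : r < lm A) :
    ∃ x, r < lm (A ∩ Iio x) := by
  have h := tendsto_measure_Iic_atTop (volume.restrict A)
  rw [Measure.restrict_apply_univ] at h
  obtain ⟨x, hx⟩ :=
    (((ENNReal.tendsto_toReal hfin).comp h).eventually (lt_mem_nhds hr)).exists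
  refine ⟨x + 1, hx.trans_le ?_⟩
  simp only [Function.comp_apply, Measure.restrict_apply measurableSet_Iic]
  rw [inter_comm]
  exact lm_mono (inter_subset_inter_right A (Iic_subset_Iio.2 (lt_add_one x)))
    (volume_inter_ne_top hfin _)

lemma exists_lm_inter_Iio_lt (hfin : volume A ≠ ⊤) {r : ℝ} (hr : 0 < r) :
    ∃ x, lm (A ∩ Iio x) < r := by
  have h := tendsto_measure_Ici_atBot (volume.restrict A)
  rw [Measure.restrict_apply_univ] at h
  obtain ⟨x, hx⟩ := (((ENNReal.tendsto_toReal hfin).comp h).eventually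
    (lt_mem_nhds (show lm A - r < lm A by linarith))).exists
  simp only [Function.comp_apply, Measure.restrict_apply measurableSet_Ici] at hx
  rw [inter_comm] at hx
  change lm A - r < lm (A ∩ Ici x) at hx
  exact ⟨x, by linarith [lm_inter_Iio_add_lm_inter_Ici hfin x]⟩

lemma exists_lm_inter_Iio_eq (hA : MeasurableSet A) (hfin : volume A ≠ ⊤) {r : ℝ}
    (h0 : 0 < r) (h1 : r < lm A) : ∃ x, lm (A ∩ Iio x) = r := by
  obtain ⟨x, hx⟩ := exists_lm_inter_Iio_lt hfin h0
  obtain ⟨y, hy⟩ := exists_lt_lm_inter_Iio hfin h1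
  exact mem_range_of_exists_le_of_exists_ge (continuous_lm_inter_Iio hA hfin)
    ⟨x, hx.le⟩ ⟨y, hy.le⟩

/-- The lower cut of a truncation removes exactly mass `ρ`. -/
lemma lm_inter_Iio_lowerCut (hA : MeasurableSet A) (hfin : volume A ≠ ⊤) {ρ : ℝ}
    (h0 : 0 < ρ) (h1 : ρ < lm A) :
    lm (A ∩ Iio (sInf {a : ℝ | lm (A ∩ Iio a) = ρ})) = ρ := by
  have hc : IsClosed {a : ℝ | lm (A ∩ Iio a) = ρ} :=
    isClosed_eq (continuous_lm_inter_Iio hA hfin) continuous_const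
  refine hc.csInf_mem (exists_lm_inter_Iio_eq hA hfin h0 h1) ?_
  obtain ⟨x, hx⟩ := exists_lm_inter_Iio_lt hfin h0
  refine ⟨x, fun a ha ↦ le_of_lt ((lm_inter_Iio_mono hfin).reflect_lt ?_)⟩
  exact hx.trans_eq (Eq.symm ha)

/-- The upper cut of a truncation removes exactly mass `ρ`. -/
lemma lm_inter_Ioi_upperCut (hA : MeasurableSet A) (hfin : volume A ≠ ⊤) {ρ : ℝ}
    (h0 : 0 < ρ) (h1 : ρ < lm A) :
    lm (A ∩ Ioi (sSup {b : ℝ | lm (A ∩ Ioi b) = ρ})) = ρ := by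
  have hc : IsClosed {b : ℝ | lm (A ∩ Ioi b) = ρ} := by
    simp only [lm_inter_Ioi hfin]
    exact isClosed_eq (continuous_const.sub (continuous_lm_inter_Iio hA hfin)) continuous_const
  refine hc.csSup_mem ?_ ?_
  · obtain ⟨x, hx⟩ := exists_lm_inter_Iio_eq hA hfin (sub_pos.2 h1) (sub_lt_self _ h0)
    exact ⟨x, by rw [mem_ofPred_eq, lm_inter_Ioi hfin, hx]; ring⟩
  · obtain ⟨x, hx⟩ := exists_lt_lm_inter_Iio hfin (sub_lt_self (lm A) h0)
    refine ⟨x, fun b hb ↦ le_of_lt ((lm_inter_Iio_mono hfin).reflect_lt ?_)⟩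
    rw [mem_ofPred_eq, lm_inter_Ioi hfin] at hb
    change lm (A ∩ Iio b) < lm (A ∩ Iio x)
    linarith

lemma trunc_subset (A : Set ℝ) (ρ ρ' : ℝ) : trunc A ρ ρ' ⊆ A :=
  inter_subset_left.trans inter_subset_left

lemma lm_inter_Iio_le_trunc (hA : MeasurableSet A) (hfin : volume A ≠ ⊤) {ρ ρ' : ℝ}
    (h0 : 0 ≤ ρ) (h1 : ρ < lm A) (h0' : 0 ≤ ρ') (h1' : ρ' < lm A) {x : ℝ}
    (hx : lm (A ∩ Iio x) < lm A - ρ') :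
    lm (A ∩ Iio x) ≤ lm (trunc A ρ ρ' ∩ Iio x) + ρ := by
  have hT : volume (trunc A ρ ρ' ∩ Iio x) ≠ ⊤ :=
    measure_ne_top_of_subset (inter_subset_left.trans (trunc_subset A ρ ρ')) hfin
  have hup : ∀ z < x, z ∈ (if ρ' = 0 then univ
      else Iic (sSup {b : ℝ | lm (A ∩ Ioi b) = ρ'})) := by
    intro z hz
    split_ifs with h
    · trivial
    · have ht := lm_inter_Ioi_upperCut hA hfin (lt_of_le_of_ne h0' (Ne.symm h)) h1'
      rw [lm_inter_Ioi hfin] at ht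
      refine hz.le.trans (le_of_lt ((lm_inter_Iio_mono hfin).reflect_lt ?_))
      change lm (A ∩ Iio x) < lm (A ∩ Iio _)
      linarith
  rcases h0.eq_or_lt with rfl | h0
  · rw [add_zero]
    refine lm_mono (fun z hz ↦ ⟨⟨⟨hz.1, ?_⟩, hup z hz.2⟩, hz.2⟩) hT
    simp
  · have hs := lm_inter_Iio_lowerCut hA hfin h0 h1
    refine (lm_le_add (fun z hz ↦ ?_) hT (volume_inter_ne_top hfin _)).trans_eq
      (congrArg _ hs)
    rcases lt_or_ge z (sInf {a : ℝ | lm (A ∩ Iio a) = ρ}) with h | h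
    · exact Or.inr ⟨hz.1, h⟩
    · refine Or.inl ⟨⟨⟨hz.1, ?_⟩, hup z hz.2⟩, hz.2⟩
      rwa [if_neg h0.ne']

lemma lm_inter_Ioi_le_trunc (hA : MeasurableSet A) (hfin : volume A ≠ ⊤) {ρ ρ' : ℝ}
    (h0 : 0 ≤ ρ) (h1 : ρ < lm A) (h0' : 0 ≤ ρ') (h1' : ρ' < lm A) {y : ℝ}
    (hy : ρ < lm (A ∩ Iio y)) :
    lm (A ∩ Ioi y) ≤ lm (trunc A ρ ρ' ∩ Ioi y) + ρ' := by
  have hT : volume (trunc A ρ ρ' ∩ Ioi y) ≠ ⊤ :=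
    measure_ne_top_of_subset (inter_subset_left.trans (trunc_subset A ρ ρ')) hfin
  have hlow : ∀ z, y < z → z ∈ (if ρ = 0 then univ
      else Ici (sInf {a : ℝ | lm (A ∩ Iio a) = ρ})) := by
    intro z hz
    split_ifs with h
    · trivial
    · have ht := lm_inter_Iio_lowerCut hA hfin (lt_of_le_of_ne h0 (Ne.symm h)) h1
      refine le_trans (le_of_lt ((lm_inter_Iio_mono hfin).reflect_lt ?_)) hz.le
      exact ht.trans_lt hy
  rcases h0'.eq_or_lt with rfl | h0'
  · rw [add_zero]
    refine lm_mono (fun z hz ↦ ⟨⟨⟨hz.1, hlow z hz.2⟩, ?_⟩, hz.2⟩) hT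
    simp
  · have hs := lm_inter_Ioi_upperCut hA hfin h0' h1'
    refine (lm_le_add (fun z hz ↦ ?_) hT (volume_inter_ne_top hfin _)).trans_eq
      (congrArg _ hs)
    rcases lt_or_ge (sSup {b : ℝ | lm (A ∩ Ioi b) = ρ'}) z with h | h
    · exact Or.inr ⟨hz.1, h⟩
    · refine Or.inl ⟨⟨⟨hz.1, hlow z hz.2⟩, ?_⟩, hz.2⟩
      rwa [if_neg h0'.ne']

/-- If a truncation is close to an interval, then `A` has small gaps well inside it. -/
lemma lm_Ico_diff_le_of_trunc (hA : MeasurableSet A) (hfin : volume A ≠ ⊤) {ρ ρ' δ a b x y : ℝ}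
    (h0 : 0 ≤ ρ) (h1 : ρ < lm A) (h0' : 0 ≤ ρ') (h1' : ρ' < lm A) (hδ : 0 ≤ δ)
    (hab : lm (symmDiff (trunc A ρ ρ') (Ioo a b)) ≤ δ) (hxy : x ≤ y)
    (hx : ρ + δ < lm (A ∩ Iio x)) (hy : lm (A ∩ Iio y) < lm A - ρ' - δ) :
    lm (Ico x y \ A) ≤ δ := by
  have hmono : lm (A ∩ Iio x) ≤ lm (A ∩ Iio y) := lm_inter_Iio_mono hfin hxy
  have hne : volume (symmDiff (trunc A ρ ρ') (Ioo a b)) ≠ ⊤ :=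
    measure_ne_top_of_subset symmDiff_le_sup
      (measure_union_ne_top (measure_ne_top_of_subset (trunc_subset A ρ ρ') hfin) (by simp))
  have hax : a < x := by
    by_contra! h
    have h2 : lm (trunc A ρ ρ' ∩ Iio x) ≤ lm (symmDiff (trunc A ρ ρ') (Ioo a b)) :=
      lm_mono (fun z hz ↦ Or.inl ⟨hz.1, fun hz' ↦ (hz.2.trans_le h).not_gt hz'.1⟩) hne
    linarith [lm_inter_Iio_le_trunc hA hfin h0 h1 h0' h1' (x := x) (by linarith)]
  have hyb : y < b := by
    by_contra! h
    have h2 : lm (trunc A ρ ρ' ∩ Ioi y) ≤ lm (symmDiff (trunc A ρ ρ') (Ioo a b)) :=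
      lm_mono (fun z hz ↦ Or.inl ⟨hz.1, fun hz' ↦ (h.trans_lt hz.2).not_gt hz'.2⟩) hne
    linarith [lm_inter_Ioi_le_trunc hA hfin h0 h1 h0' h1' (y := y) (by linarith),
      lm_inter_Ioi hfin y]
  refine le_trans (lm_mono (fun z hz ↦ Or.inr ⟨⟨?_, ?_⟩, ?_⟩) hne) hab
  · exact hax.trans_le hz.1.1
  · exact hz.1.2.trans hyb
  · exact fun h ↦ hz.2 (trunc_subset A ρ ρ' h)

/-- Chaining of gap bounds over consecutive pieces of mass at most `d`. -/
lemma lm_Ico_diff_le_nsmul (hA : MeasurableSet A) (hfin : volume A ≠ ⊤) {d δ x w : ℝ}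
    (hd : 0 ≤ d) (hδ : 0 ≤ δ)
    (hstep : ∀ u v, x ≤ u → u ≤ v → v ≤ w →
      lm (A ∩ Iio v) - lm (A ∩ Iio u) ≤ d → lm (Ico u v \ A) ≤ δ) (n : ℕ) :
    ∀ y, x ≤ y → y ≤ w → lm (A ∩ Iio y) - lm (A ∩ Iio x) ≤ n * d →
      lm (Ico x y \ A) ≤ (n + 1) * δ := by
  induction n with
  | zero =>
    intro y hxy hyw h
    simp only [Nat.cast_zero, zero_mul] at h
    simpa using hstep x y le_rfl hxy hyw (h.trans hd)
  | succ n ih =>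
    intro y hxy hyw h
    push_cast at h ⊢
    rcases le_or_gt (lm (A ∩ Iio y) - lm (A ∩ Iio x)) (n * d) with h' | h'
    · linarith [ih y hxy hyw h']
    · obtain ⟨z, hz, hzeq⟩ := intermediate_value_Icc hxy
        (continuous_lm_inter_Iio hA hfin).continuousOn
        (show lm (A ∩ Iio x) + n * d ∈ Icc (lm (A ∩ Iio x)) (lm (A ∩ Iio y)) from
          ⟨by have : 0 ≤ n * d := by positivity
              linarith, by linarith⟩)
      change lm (A ∩ Iio z) = _ at hzeq
      have e1 := ih z hz.1 (hz.2.trans hyw) (by linarith)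
      have e2 := hstep z y hz.1 hz.2 hyw (by linarith)
      rw [lm_Ico_diff hA hfin hz.1] at e1
      rw [lm_Ico_diff hA hfin hz.2] at e2
      rw [lm_Ico_diff hA hfin hxy]
      linarith

lemma lm_symmDiff_Ioo_le (hfin : volume A ≠ ⊤) (x y : ℝ) :
    lm (symmDiff A (Ioo x y)) ≤
      lm (A ∩ Iio x) + (lm A - lm (A ∩ Iio y)) + lm (Ico x y \ A) := by
  have hI : volume (Ico x y \ A) ≠ ⊤ := measure_ne_top_of_subset sdiff_subset (by simp)
  have h0 : lm (A ∩ {x}) = 0 := measureReal_mono_null inter_subset_right (by simp [Measure.real]) (by simp)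
  have h1 : symmDiff A (Ioo x y) ⊆
      (((A ∩ Iio x) ∪ (A ∩ Ici y)) ∪ (A ∩ {x})) ∪ (Ico x y \ A) := by
    rintro z (⟨hz, hz'⟩ | ⟨hz, hz'⟩)
    · rcases lt_trichotomy z x with h | h | h
      · exact Or.inl (Or.inl (Or.inl ⟨hz, h⟩))
      · exact Or.inl (Or.inr ⟨hz, h⟩)
      · exact Or.inl (Or.inl (Or.inr ⟨hz, not_lt.1 fun h' ↦ hz' ⟨h, h'⟩⟩))
    · exact Or.inr ⟨Ioo_subset_Ico_self hz, hz'⟩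
  have hf := volume_inter_ne_top hfin
  have h2 := lm_le_add h1
    (measure_union_ne_top (measure_union_ne_top (hf _) (hf _)) (hf _)) hI
  have h3 := lm_union_le ((A ∩ Iio x) ∪ (A ∩ Ici y)) (A ∩ {x})
  have h4 := lm_union_le (A ∩ Iio x) (A ∩ Ici y)
  linarith [lm_inter_Iio_add_lm_inter_Ici hfin y]

end Distribution

/-- If all truncations of `A` of relative measure `λ` nearly coincide with
intervals, then `A` itself nearly coincides with an interval. -/
theorem truncations_interval_stability :
    ∃ K : ℝ, 0 < K ∧
      ∀ (A : Set ℝ), MeasurableSet A → 0 < volume A → volume A ≠ ⊤ →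
      ∀ (ε lam : ℝ), 0 < ε → 0 < lam → lam < 1 →
      (∀ ρ ρ' : ℝ, 0 ≤ ρ → 0 ≤ ρ' → ρ + ρ' = (1 - lam) * lm A →
        ∃ a b : ℝ, lm (symmDiff (trunc A ρ ρ') (Set.Ioo a b)) ≤ ε * lm A) →
      ∃ a b : ℝ, lm (symmDiff A (Set.Ioo a b)) ≤ K * lam⁻¹ * ε * lm A := by
  refine ⟨8, by norm_num, fun A hA hpos hfin ε lam hε hlam hlam1 H ↦ ?_⟩
  have hm : 0 < lm A := ENNReal.toReal_pos hpos.ne' hfin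
  set m := lm A with hmdef
  have hlm : 0 < lam * m := by positivity
  have hεm : 0 < ε * m := by positivity
  rcases le_or_gt lam (8 * ε) with hbig | hsmall
  · refine ⟨0, 0, ?_⟩
    have h1 : 1 ≤ 8 * lam⁻¹ * ε := by
      rw [show 8 * lam⁻¹ * ε = (8 * ε) / lam by ring]
      exact (one_le_div hlam).2 hbig
    rw [Ioo_self, ← bot_eq_empty, symmDiff_bot]
    simpa only [one_mul] using mul_le_mul_of_nonneg_right h1 hm.le
  have hs : 8 * (ε * m) < lam * m := by nlinarith
  have hlm1 : lam * m < m := by nlinarith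
  obtain ⟨x, hx⟩ := exists_lm_inter_Iio_eq hA hfin (r := 2 * (ε * m)) (by linarith) (by linarith)
  obtain ⟨w, hw⟩ := exists_lm_inter_Iio_eq hA hfin (r := m - 2 * (ε * m)) (by linarith)
    (by linarith)
  have hmono := lm_inter_Iio_mono hfin
  have hxw : x ≤ w := (hmono.reflect_lt (show lm (A ∩ Iio x) < lm (A ∩ Iio w) by linarith)).le
  have hstep : ∀ u v, x ≤ u → u ≤ v → v ≤ w →
      lm (A ∩ Iio v) - lm (A ∩ Iio u) ≤ lam * m / 2 → lm (Ico u v \ A) ≤ ε * m := by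
    intro u v hxu huv hvw hd
    have h1 : lm (A ∩ Iio x) ≤ lm (A ∩ Iio u) := hmono hxu
    have h2 : lm (A ∩ Iio v) ≤ lm (A ∩ Iio w) := hmono hvw
    obtain ⟨ρ, hρ0, hρ1, hρu, hρv⟩ : ∃ ρ, 0 ≤ ρ ∧ ρ ≤ (1 - lam) * m ∧
        ρ + ε * m < lm (A ∩ Iio u) ∧ lm (A ∩ Iio v) < ρ + lam * m - ε * m := by
      rcases le_total (lm (A ∩ Iio u) - 2 * (ε * m)) ((1 - lam) * m) with h | h
      · exact ⟨_, by linarith, h, by linarith, by linarith⟩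
      · exact ⟨_, by nlinarith, le_rfl, by linarith, by linarith⟩
    obtain ⟨a, b, hab⟩ := H ρ ((1 - lam) * m - ρ) hρ0 (by linarith) (by ring)
    exact lm_Ico_diff_le_of_trunc hA hfin hρ0 (by linarith) (by linarith) (by linarith) hεm.le
      hab huv hρu (by linarith)
  have hn : 2 / lam ≤ ⌈2 / lam⌉₊ := Nat.le_ceil _
  have hn' : (⌈2 / lam⌉₊ : ℝ) < 2 / lam + 1 := Nat.ceil_lt_add_one (by positivity)
  have hone : 1 ≤ 1 / lam := (one_le_div hlam).2 hlam1.le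
  have hmass : m ≤ ⌈2 / lam⌉₊ * (lam * m / 2) :=
    calc m = 2 / lam * (lam * m / 2) := by field_simp
      _ ≤ _ := by gcongr
  have hgap := lm_Ico_diff_le_nsmul hA hfin (by positivity) hεm.le hstep ⌈2 / lam⌉₊ w hxw le_rfl
    (by linarith)
  refine ⟨x, w, (lm_symmDiff_Ioo_le hfin x w).trans ?_⟩
  have hcount : (⌈2 / lam⌉₊ + 1 : ℝ) * (ε * m) ≤ (4 * (1 / lam)) * (ε * m) := by
    gcongr
    have : 2 / lam = 2 * (1 / lam) := by ring
    linarith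
  have hfour : 4 * (ε * m) ≤ 4 * (1 / lam) * (ε * m) := by
    gcongr
    linarith
  calc _ ≤ 4 * (1 / lam) * (ε * m) + 4 * (1 / lam) * (ε * m) := by linarith
    _ = 8 * lam⁻¹ * ε * m := by ring
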